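/- Let 1 ≤ k ≤ d. For each divisor e of gcd(d,k) let T_e be a transversal of the translation orbits of the k-element subsets of ZMod d whose stabilizer has order exactly e, i.e. T_e is a finite set of such subsets containing exactly one member of each such orbit. Then the k-th Viète coefficient a_k of the period polynomial, defined by a_k = ∑_{S ⊆ ZMod d, |S| = k} ∏_{s ∈ S} η_s (so that ∏_{j ∈ ZMod d}(X − η_j) = X^d + ∑_{k=1}^{d} (−1)^k a_k X^{d−k}), satisfies a_k = ∑_{e ∣ gcd(d,k)} (1/e)·(p·∑_{S ∈ T_e} z(S) − |T_e|·m^{k−1}). -/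

import Mathlib

/-- The coset `C_s = g^s · C₀` (as a subset of `ZMod p`) of the subgroup `C₀` of
d-th powers of units, for `s : ZMod d`. -/
def Cset (p d : ℕ) [NeZero p] (g : (ZMod p)ˣ) (s : ZMod d) : Finset (ZMod p) :=
  Finset.univ.filter fun x : ZMod p =>
    ∃ y : (ZMod p)ˣ, x = (g : ZMod p) ^ s.val * (y : ZMod p) ^ d

/-- The Gauss d-period `η_j = ∑_{x ∈ C_j} ζ^x`. -/
noncomputable def eta (p d : ℕ) [NeZero p] (g : (ZMod p)ˣ) (ζ : ℂ) (j : ZMod d) : ℂ :=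
  ∑ x ∈ Cset p d g j, ζ ^ x.val

/-- The Gauss symbol `N(S)`. -/
noncomputable def gaussN (p d : ℕ) [NeZero p] (g : (ZMod p)ˣ) (S : Finset (ZMod d)) : ℕ :=
  Nat.card {f : S → ZMod p //
    (∀ s : S, f s ∈ Cset p d g (s : ZMod d)) ∧ ∑ s : S, f s = 0}

/-- The translation stabilizer `{ν ∈ ZMod d : ν + S = S}` of a subset `S ⊆ ZMod d`. -/
def stabF {d : ℕ} [NeZero d] (S : Finset (ZMod d)) : Finset (ZMod d) :=
  Finset.univ.filter fun ν => S.image (fun s => ν + s) = S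

/-- The translation orbit `{ν + S : ν ∈ ZMod d}` of a subset `S ⊆ ZMod d`. -/
def orbF {d : ℕ} [NeZero d] (S : Finset (ZMod d)) : Finset (Finset (ZMod d)) :=
  Finset.univ.image fun ν => S.image (fun s => ν + s)

/-- A subset of a finite abelian group that is stable under translation by a subset `H`, where `H`
is closed under subtraction, has cardinality divisible by that of `H`. -/
theorem card_dvd_card_of_add_mem {G : Type*} [AddCommGroup G] [DecidableEq G] {H S : Finset G}
    (h0 : 0 ∈ H) (hsub : ∀ a ∈ H, ∀ b ∈ H, a - b ∈ H)
    (hS : ∀ a ∈ H, ∀ s ∈ S, a + s ∈ S) : H.card ∣ S.card := by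
  open scoped Pointwise in
  have hadd : S + H = S := by
    ext x
    constructor
    · intro hx
      obtain ⟨s, hs, a, ha, rfl⟩ := Finset.mem_add.1 hx
      rw [add_comm]
      exact hS a ha s hs
    · intro hx
      exact Finset.mem_add.2 ⟨x, hx, 0, h0, add_zero x⟩
  rw [← hadd]
  apply Finset.card_dvd_card_add_right
  rintro _ ⟨a, -, rfl⟩ _ ⟨b, -, rfl⟩ hne
  simp only [Function.onFun, id]
  rw [Finset.disjoint_left]
  intro x hx hx'
  apply hne
  obtain ⟨u, hu, rfl⟩ := Finset.mem_vadd_finset.1 hx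
  obtain ⟨v, hv, huv⟩ := Finset.mem_vadd_finset.1 hx'
  simp only [vadd_eq_add] at huv
  have hneg : ∀ w ∈ H, -w ∈ H := fun w hw => by simpa using hsub 0 h0 w hw
  have hba : b = a + (u - v) := by rw [← add_sub_assoc, ← huv]; abel
  have hab : a = b + (v - u) := by rw [hba]; abel
  ext y
  simp only [Finset.mem_vadd_finset, vadd_eq_add]
  constructor
  · rintro ⟨w, hw, rfl⟩
    refine ⟨w - (u - v), hsub _ hw _ (hsub _ hu _ hv), ?_⟩
    rw [hba]; abel
  · rintro ⟨w, hw, rfl⟩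
    refine ⟨w - (v - u), hsub _ hw _ (hsub _ hv _ hu), ?_⟩
    rw [hba]; abel

section Translation

variable {d : ℕ}

theorem image_add_image_add (ν μ : ZMod d) (S : Finset (ZMod d)) :
    (S.image fun s => μ + s).image (fun s => ν + s) = S.image fun s => ν + μ + s := by
  rw [Finset.image_image]
  congr 1
  funext s
  simp [add_assoc]

theorem card_image_add (ν : ZMod d) (S : Finset (ZMod d)) :
    (S.image fun s => ν + s).card = S.card :=
  Finset.card_image_of_injective _ (add_right_injective ν)

theorem image_add_eq_iff (ν : ZMod d) (S S' : Finset (ZMod d)) :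
    S.image (fun s => ν + s) = S' ↔ S = S'.image fun s => -ν + s := by
  constructor <;> rintro rfl <;> rw [image_add_image_add] <;> simp only [neg_add_cancel,
    add_neg_cancel, zero_add, Finset.image_id']

theorem mem_stabF [NeZero d] {ν : ZMod d} {S : Finset (ZMod d)} :
    ν ∈ stabF S ↔ S.image (fun s => ν + s) = S := by
  simp [stabF]

theorem stabF_image_add [NeZero d] (ν : ZMod d) (S : Finset (ZMod d)) :
    stabF (S.image fun s => ν + s) = stabF S := by
  ext μ
  rw [mem_stabF, mem_stabF, image_add_image_add, add_comm, ← image_add_image_add]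
  exact (Finset.image_injective (add_right_injective ν)).eq_iff

theorem card_stabF_dvd_gcd [NeZero d] (S : Finset (ZMod d)) : (stabF S).card ∣ Nat.gcd d S.card := by
  have h0 : (0 : ZMod d) ∈ stabF S := by simp [mem_stabF]
  have hsub : ∀ a ∈ stabF S, ∀ b ∈ stabF S, a - b ∈ stabF S := by
    intro a ha b hb
    rw [mem_stabF] at *
    have hb' := (image_add_eq_iff b S S).1 hb
    rw [sub_eq_add_neg, ← image_add_image_add, ← hb', ha]
  refine Nat.dvd_gcd ?_ ?_
  · have := card_dvd_card_of_add_mem (S := Finset.univ) h0 hsub (by simp)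
    simpa [ZMod.card] using this
  · refine card_dvd_card_of_add_mem h0 hsub fun a ha s hs => ?_
    rw [mem_stabF] at ha
    rw [← ha]
    exact Finset.mem_image_of_mem _ hs

/-- Summing over the translates of a transversal counts every set with stabilizer of order `e`
exactly `e` times. -/
theorem sum_transversal_translates [NeZero d] {M : Type*} [AddCommMonoid M] (k e : ℕ)
    (T : Finset (Finset (ZMod d)))
    (hT1 : ∀ S ∈ T, S.card = k ∧ (stabF S).card = e)
    (hT2 : ∀ S : Finset (ZMod d), S.card = k → (stabF S).card = e →
      ∃! S', S' ∈ T ∧ S' ∈ orbF S) (F : Finset (ZMod d) → M) :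
    ∑ S ∈ T, ∑ ν : ZMod d, F (S.image fun s => ν + s)
      = e • ∑ S ∈ (Finset.powersetCard k Finset.univ).filter (fun S => (stabF S).card = e), F S := by
  rw [← Finset.sum_product', ← Finset.sum_fiberwise_of_maps_to
    (t := (Finset.powersetCard k Finset.univ).filter (fun S => (stabF S).card = e))
    (g := fun q : Finset (ZMod d) × ZMod d => q.1.image fun s => q.2 + s), Finset.smul_sum]
  · refine Finset.sum_congr rfl fun S hS => ?_
    simp only [Finset.mem_filter, Finset.mem_powersetCard, Finset.subset_univ, true_and] at hS
    rw [Finset.sum_congr rfl (g := fun _ => F S)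
      (fun q hq => by rw [(Finset.mem_filter.1 hq).2]), Finset.sum_const]
    congr 1
    obtain ⟨S₀, ⟨hS₀T, hS₀⟩, huniq⟩ := hT2 S hS.1 hS.2
    obtain ⟨μ, -, rfl⟩ := Finset.mem_image.1 hS₀
    rw [← hS.2]
    refine Finset.card_bij' (fun q _ => q.2 + μ)
      (fun ν _ => (S.image fun s => μ + s, ν - μ)) ?_ ?_ ?_ ?_
    · rintro ⟨S', ν⟩ hq
      simp only [Finset.mem_filter, Finset.mem_product, Finset.mem_univ, and_true] at hq
      have hS' := huniq S' ⟨hq.1, Finset.mem_image.2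
        ⟨-ν, Finset.mem_univ _, ((image_add_eq_iff ν S' S).1 hq.2).symm⟩⟩
      rw [mem_stabF, ← image_add_image_add, ← hS', hq.2]
    · intro ν hν
      rw [mem_stabF] at hν
      simp only [Finset.mem_filter, Finset.mem_product, Finset.mem_univ, and_true]
      exact ⟨hS₀T, by rw [image_add_image_add, sub_add_cancel, hν]⟩
    · rintro ⟨S', ν⟩ hq
      simp only [Finset.mem_filter, Finset.mem_product, Finset.mem_univ, and_true] at hq
      have hS' := huniq S' ⟨hq.1, Finset.mem_image.2
        ⟨-ν, Finset.mem_univ _, ((image_add_eq_iff ν S' S).1 hq.2).symm⟩⟩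
      simp [hS']
    · intro ν _
      simp
  · rintro ⟨S, ν⟩ hq
    have hS := hT1 S (Finset.mem_product.1 hq).1
    rw [Finset.mem_filter, Finset.mem_powersetCard, card_image_add, stabF_image_add]
    exact ⟨⟨Finset.subset_univ _, hS.1⟩, hS.2⟩

end Translation

section Cyclotomic

variable {p d m : ℕ} [Fact p.Prime] {g : (ZMod p)ˣ}

theorem mem_Cset_iff [NeZero d] (hg : ∀ x : (ZMod p)ˣ, ∃ n : ℕ, g ^ n = x) {s : ZMod d} {x : ZMod p} :
    x ∈ Cset p d g s ↔ ∃ n : ℤ, x = ((g ^ n : (ZMod p)ˣ) : ZMod p) ∧ (n : ZMod d) = s := by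
  simp only [Cset, Finset.mem_filter, Finset.mem_univ, true_and]
  constructor
  · rintro ⟨y, rfl⟩
    obtain ⟨j, rfl⟩ := hg y
    refine ⟨((s.val + j * d : ℕ) : ℤ), ?_, by simp⟩
    rw [zpow_natCast, pow_add, pow_mul]
    push_cast
    rfl
  · rintro ⟨n, rfl, rfl⟩
    refine ⟨g ^ (n / d), ?_⟩
    have h : (((n : ZMod d).val : ℕ) : ℤ) = n % d := ZMod.val_intCast n
    have h2 : g ^ n = g ^ (n : ZMod d).val * (g ^ (n / (d : ℤ))) ^ d := by
      rw [← zpow_natCast g, h, ← zpow_natCast (g ^ (n / (d : ℤ))), ← zpow_mul, ← zpow_add,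
        mul_comm (n / (d : ℤ)), Int.emod_add_mul_ediv]
    rw [h2]
    push_cast
    rfl

theorem mul_mem_Cset [NeZero d] (hg : ∀ x : (ZMod p)ˣ, ∃ n : ℕ, g ^ n = x) {s : ZMod d} {x : ZMod p}
    (a : ℤ) (hx : x ∈ Cset p d g s) :
    ((g ^ a : (ZMod p)ˣ) : ZMod p) * x ∈ Cset p d g (a + s) := by
  obtain ⟨n, rfl, rfl⟩ := (mem_Cset_iff hg).1 hx
  exact (mem_Cset_iff hg).2 ⟨a + n, by rw [zpow_add]; simp, by push_cast; rfl⟩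

theorem sum_Cset_mul [NeZero d] {M : Type*} [AddCommMonoid M] (hg : ∀ x : (ZMod p)ˣ, ∃ n : ℕ, g ^ n = x)
    (a : ℤ) (s : ZMod d) (f : ZMod p → M) :
    ∑ x ∈ Cset p d g s, f (((g ^ a : (ZMod p)ˣ) : ZMod p) * x)
      = ∑ x ∈ Cset p d g (a + s), f x := by
  refine Finset.sum_nbij' (fun x => ((g ^ a : (ZMod p)ˣ) : ZMod p) * x)
    (fun x => ((g ^ (-a) : (ZMod p)ˣ) : ZMod p) * x) (fun x hx => mul_mem_Cset hg a hx) ?_ ?_ ?_ ?_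
  · intro x hx
    simpa using mul_mem_Cset hg (-a) hx
  · intro x _
    rw [← mul_assoc, ← Units.val_mul, ← zpow_add]
    simp
  · intro x _
    rw [← mul_assoc, ← Units.val_mul, ← zpow_add]
    simp
  · intro x _
    rfl

theorem card_Cset_eq [NeZero d] (hg : ∀ x : (ZMod p)ˣ, ∃ n : ℕ, g ^ n = x) (s : ZMod d) :
    (Cset p d g s).card = (Cset p d g (0 : ZMod d)).card := by
  have h := sum_Cset_mul hg s.val (0 : ZMod d) (fun _ => (1 : ℕ))
  simpa using h.symm

theorem sum_ne_zero_eq_sum_Cset [NeZero d] {M : Type*} [AddCommMonoid M] (hdm : p - 1 = d * m)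
    (hg : ∀ x : (ZMod p)ˣ, ∃ n : ℕ, g ^ n = x) (f : ZMod p → M) :
    ∑ x ∈ Finset.univ.erase 0, f x = ∑ s : ZMod d, ∑ x ∈ Cset p d g s, f x := by
  rw [← Finset.sum_biUnion]
  · refine Finset.sum_congr ?_ fun _ _ => rfl
    ext x
    simp only [Finset.mem_erase, Finset.mem_univ, and_true, Finset.mem_biUnion, true_and]
    constructor
    · intro hx
      obtain ⟨n, hn⟩ := hg (Units.mk0 x hx)
      exact ⟨n, (mem_Cset_iff hg).2 ⟨n, by simpa using (congrArg Units.val hn).symm, by simp⟩⟩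
    · rintro ⟨s, hs⟩
      obtain ⟨n, rfl, -⟩ := (mem_Cset_iff hg).1 hs
      exact Units.ne_zero _
  · intro s _ t _ hst
    simp only [Function.onFun]
    rw [Finset.disjoint_left]
    intro x hx hx'
    obtain ⟨a, rfl, rfl⟩ := (mem_Cset_iff hg).1 hx
    obtain ⟨b, hab, rfl⟩ := (mem_Cset_iff hg).1 hx'
    apply hst
    have ho : orderOf g = d * m := by
      rw [orderOf_eq_card_of_forall_mem_zpowers, Nat.card_eq_fintype_card, ZMod.card_units, hdm]
      intro x
      obtain ⟨n, rfl⟩ := hg x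
      exact ⟨n, by simp⟩
    have h := zpow_eq_zpow_iff_modEq.1 (Units.ext hab)
    rw [ho, Nat.cast_mul] at h
    exact (ZMod.intCast_eq_intCast_iff a b d).2 (h.of_mul_right _)

theorem card_Cset [NeZero d] (hdm : p - 1 = d * m)
    (hg : ∀ x : (ZMod p)ˣ, ∃ n : ℕ, g ^ n = x) (s : ZMod d) : (Cset p d g s).card = m := by
  have h := sum_ne_zero_eq_sum_Cset hdm hg (fun _ => (1 : ℕ))
  simp only [Finset.sum_const, smul_eq_mul, mul_one, card_Cset_eq hg, Finset.card_univ,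
    ZMod.card, Finset.mem_univ, Finset.card_erase_of_mem, hdm] at h
  rw [card_Cset_eq hg]
  exact (Nat.eq_of_mul_eq_mul_left (NeZero.pos d) h).symm

/-- Orthogonality of additive characters counts the zero-sum functions. -/
theorem sum_prod_addChar_eq_mul_gaussN {ψ : AddChar (ZMod p) ℂ} (hψ : ψ.IsPrimitive)
    (S : Finset (ZMod d)) :
    ∑ t : ZMod p, ∏ s ∈ S, ∑ x ∈ Cset p d g s, ψ (t * x) = (p : ℂ) * (gaussN p d g S : ℂ) := by
  have hexp : ∀ t : ZMod p, ∏ s ∈ S, ∑ x ∈ Cset p d g s, ψ (t * x)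
      = ∑ f ∈ Fintype.piFinset (fun s : S => Cset p d g (s : ZMod d)), ψ (t * ∑ s, f s) := by
    intro t
    rw [← Finset.prod_coe_sort, Finset.prod_univ_sum]
    refine Finset.sum_congr rfl fun f _ => ?_
    rw [Finset.mul_sum]
    exact (map_prod ψ.toMonoidHom (fun s => Multiplicative.ofAdd (t * f s)) Finset.univ).symm
  have hN : gaussN p d g S = ((Fintype.piFinset (fun s : S => Cset p d g (s : ZMod d))).filter
      (fun f => ∑ s, f s = 0)).card := by
    rw [gaussN, Nat.card_eq_fintype_card, Fintype.card_subtype]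
    congr 1
    ext f
    simp only [Finset.mem_filter, Finset.mem_univ, true_and, Fintype.mem_piFinset]
  simp only [hexp]
  rw [Finset.sum_comm]
  simp only [AddChar.sum_mulShift _ hψ, ZMod.card]
  rw [hN, ← Nat.cast_sum, Finset.sum_ite]
  simp [mul_comm]

theorem eta_eq_sum_addChar [NeZero d] {ζ : ℂ} (h : ζ ^ p = 1) (a : ℤ)
    (hg : ∀ x : (ZMod p)ˣ, ∃ n : ℕ, g ^ n = x) (s : ZMod d) :
    ∑ x ∈ Cset p d g s, AddChar.zmodChar p h (((g ^ a : (ZMod p)ˣ) : ZMod p) * x)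
      = eta p d g ζ (a + s) :=
  sum_Cset_mul hg a s fun x => AddChar.zmodChar p h x

theorem card_mul_sum_prod_eta [NeZero d] (hdm : p - 1 = d * m)
    (hg : ∀ x : (ZMod p)ˣ, ∃ n : ℕ, g ^ n = x) {ζ : ℂ} (hζ : IsPrimitiveRoot ζ p)
    (S : Finset (ZMod d)) :
    (m : ℂ) * ∑ ν : ZMod d, ∏ s ∈ S, eta p d g ζ (ν + s)
      = (p : ℂ) * (gaussN p d g S : ℂ) - (m : ℂ) ^ S.card := by
  have hψ := AddChar.zmodChar_primitive_of_primitive_root p hζ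
  rw [← sum_prod_addChar_eq_mul_gaussN hψ S,
    ← Finset.add_sum_erase _ _ (Finset.mem_univ (0 : ZMod p)),
    sum_ne_zero_eq_sum_Cset hdm hg]
  have h0 : ∏ s ∈ S, ∑ x ∈ Cset p d g s,
      AddChar.zmodChar p ((IsPrimitiveRoot.iff_def ζ p).mp hζ).left (0 * x)
        = (m : ℂ) ^ S.card := by
    simp [card_Cset hdm hg]
  rw [h0, add_sub_cancel_left, Finset.mul_sum]
  refine Finset.sum_congr rfl fun ν _ => ?_
  rw [Finset.sum_congr rfl (g := fun _ => ∏ s ∈ S, eta p d g ζ (ν + s)), Finset.sum_const,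
    card_Cset hdm hg, nsmul_eq_mul]
  intro t ht
  obtain ⟨a, rfl, rfl⟩ := (mem_Cset_iff hg).1 ht
  exact Finset.prod_congr rfl fun s _ => eta_eq_sum_addChar _ a hg s

theorem isIntegral_eta {ζ : ℂ} (hζ : IsPrimitiveRoot ζ p) (s : ZMod d) :
    IsIntegral ℤ (eta p d g ζ s) :=
  IsIntegral.sum _ fun _ _ => (hζ.isIntegral (NeZero.pos p)).pow _

/-- The order `m` of the group of `d`-th powers divides the Gauss symbols, since the sum of the
translated products of periods is an algebraic integer and `m` is coprime to `p`. -/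
theorem dvd_gaussN [NeZero d] (hdm : p - 1 = d * m) (hm : m ≠ 0)
    (hg : ∀ x : (ZMod p)ˣ, ∃ n : ℕ, g ^ n = x) {ζ : ℂ} (hζ : IsPrimitiveRoot ζ p)
    {S : Finset (ZMod d)} (hS : S.card ≠ 0) : m ∣ gaussN p d g S := by
  have hmC : (m : ℂ) ≠ 0 := Nat.cast_ne_zero.2 hm
  set A := ∑ ν : ZMod d, ∏ s ∈ S, eta p d g ζ (ν + s) with hA
  have hAint : IsIntegral ℤ A :=
    IsIntegral.sum _ fun ν _ => IsIntegral.prod _ fun s _ => isIntegral_eta hζ _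
  have hmul : (m : ℂ) * A = (p : ℂ) * (gaussN p d g S : ℂ) - (m : ℂ) ^ S.card :=
    card_mul_sum_prod_eta hdm hg hζ S
  have hq : algebraMap ℚ ℂ ((p : ℚ) * gaussN p d g S / m - (m : ℚ) ^ (S.card - 1)) = A := by
    apply mul_left_cancel₀ hmC
    rw [hmul]
    simp only [eq_ratCast]
    push_cast
    rw [mul_sub, mul_div_cancel₀ _ hmC, mul_pow_sub_one hS]
  rw [← hq, isIntegral_algebraMap_iff (algebraMap ℚ ℂ).injective,
    IsIntegrallyClosed.isIntegral_iff] at hAint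
  obtain ⟨z, hz⟩ := hAint
  have hmQ : (m : ℚ) ≠ 0 := Nat.cast_ne_zero.2 hm
  have hz' : (p : ℤ) * gaussN p d g S = m * (z + m ^ (S.card - 1)) := by
    have : (p : ℚ) * gaussN p d g S = m * (z + m ^ (S.card - 1)) := by
      rw [eq_intCast] at hz
      rw [hz]
      field_simp
      ring
    exact_mod_cast this
  have hdvd : m ∣ p * gaussN p d g S := by
    have : (m : ℤ) ∣ p * gaussN p d g S := ⟨_, hz'⟩
    exact_mod_cast this
  have hp := (Fact.out : p.Prime)
  refine Nat.Coprime.dvd_of_dvd_mul_left (Nat.Coprime.symm ?_) hdvd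
  have hmp : m < p := by
    have h1 : m ≤ d * m := Nat.le_mul_of_pos_left m (NeZero.pos d)
    have h2 := hp.one_lt
    omega
  exact (Nat.Prime.coprime_iff_not_dvd hp).2 (Nat.not_dvd_of_pos_of_lt (Nat.pos_of_ne_zero hm) hmp)

theorem sum_prod_eta [NeZero d] (hdm : p - 1 = d * m) (hm : m ≠ 0)
    (hg : ∀ x : (ZMod p)ˣ, ∃ n : ℕ, g ^ n = x) {ζ : ℂ} (hζ : IsPrimitiveRoot ζ p)
    {S : Finset (ZMod d)} (hS : S.card ≠ 0) :
    ∑ ν : ZMod d, ∏ s ∈ S, eta p d g ζ (ν + s)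
      = (p : ℂ) * ((gaussN p d g S / m : ℕ) : ℂ) - (m : ℂ) ^ (S.card - 1) := by
  have hmC : (m : ℂ) ≠ 0 := Nat.cast_ne_zero.2 hm
  apply mul_left_cancel₀ hmC
  rw [card_mul_sum_prod_eta hdm hg hζ S, Nat.cast_div (dvd_gaussN hdm hm hg hζ hS) hmC,
    mul_sub, mul_pow_sub_one hS]
  field_simp

end Cyclotomic

/-- Theorem 1: the k-th Viète coefficient
a_k = ∑_{|S| = k} ∏_{s ∈ S} η_s of the period polynomial equals
∑_{e ∣ gcd(d,k)} (1/e)·(p·∑_{S ∈ T_e} z(S) − |T_e|·m^{k−1}), where T_e is any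
transversal of the translation orbits of k-element subsets with stabilizer of
order exactly e, and z(S) = N(S)/m. -/
theorem viete_coefficient_formula (p d m k : ℕ) [Fact p.Prime] [NeZero d]
    (hp : Odd p) (hd2 : 2 ≤ d) (hdm : p - 1 = d * m)
    (g : (ZMod p)ˣ) (hg : ∀ x : (ZMod p)ˣ, ∃ n : ℕ, g ^ n = x)
    (ζ : ℂ) (hζ : IsPrimitiveRoot ζ p)
    (hk1 : 1 ≤ k) (hkd : k ≤ d)
    (T : ℕ → Finset (Finset (ZMod d)))
    (hT1 : ∀ e ∈ (Nat.gcd d k).divisors, ∀ S ∈ T e, S.card = k ∧ (stabF S).card = e)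
    (hT2 : ∀ e ∈ (Nat.gcd d k).divisors, ∀ S : Finset (ZMod d),
      S.card = k → (stabF S).card = e → ∃! S', S' ∈ T e ∧ S' ∈ orbF S) :
    ∑ S ∈ Finset.powersetCard k (Finset.univ : Finset (ZMod d)), ∏ s ∈ S, eta p d g ζ s
      = ∑ e ∈ (Nat.gcd d k).divisors,
          (1 / (e : ℂ)) * ((p : ℂ) * (∑ S ∈ T e, ((gaussN p d g S / m : ℕ) : ℂ))
            - ((T e).card : ℂ) * (m : ℂ) ^ (k - 1)) := by
  have hm : m ≠ 0 := by
    rintro rfl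
    obtain ⟨j, hj⟩ := hp
    have h1 := (Fact.out : p.Prime).one_lt
    omega
  have hmaps : ∀ S ∈ Finset.powersetCard k (Finset.univ : Finset (ZMod d)),
      (stabF S).card ∈ (Nat.gcd d k).divisors := by
    intro S hS
    rw [Finset.mem_powersetCard] at hS
    refine Nat.mem_divisors.2 ⟨hS.2 ▸ card_stabF_dvd_gcd S, ?_⟩
    exact (Nat.gcd_pos_of_pos_left _ (NeZero.pos d)).ne'
  rw [← Finset.sum_fiberwise_of_maps_to hmaps]
  refine Finset.sum_congr rfl fun e he => ?_
  have he0 : (e : ℂ) ≠ 0 := Nat.cast_ne_zero.2 (Nat.pos_of_mem_divisors he).ne'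
  have hsum := sum_transversal_translates k e (T e) (hT1 e he) (hT2 e he)
    (fun S => ∏ s ∈ S, eta p d g ζ s)
  rw [nsmul_eq_mul] at hsum
  rw [one_div, eq_inv_mul_iff_mul_eq₀ he0, ← hsum, Finset.mul_sum, ← nsmul_eq_mul,
    ← Finset.sum_const, ← Finset.sum_sub_distrib]
  refine Finset.sum_congr rfl fun S hS => ?_
  have hcard := (hT1 e he S hS).1
  rw [← hcard, ← sum_prod_eta hdm hm hg hζ (by omega : S.card ≠ 0)]
  exact Finset.sum_congr rfl fun ν _ => Finset.prod_image (add_right_injective ν).injOn
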